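/- Let ν be an integrable measure on ℝⁿ concentrated on A_{[n]}, and let (ℱ_e, ℱ_o) with ℱ_e, ℱ_o ⊆ 𝒫([n]) be a proper generating pair. Then ν is universal on the space ℳ^int(A_{[n]}; ℱ_e, ℱ_o) of integrable measures concentrated on A_{[n]} that are even under T_F for all F ∈ ℱ_e and odd under T_F for all F ∈ ℱ_o, if and only if δ_J⊛ν ≠ 0 for every J ∈ 𝒥(ℱ_e, ℱ_o). Moreover, in this case, if ν is even (odd) under T_E for some E ⊆ [n], then E ∈ 𝒢_e (respectively E ∈ 𝒢_o), where 𝒢 is the group generated by ℱ_e ∪ ℱ_o. -/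

import Mathlib

open MeasureTheory
open scoped ENNReal symmDiff Classical

noncomputable section

/-- The Euclidean (ℓ²) norm on `Fin n → ℝ`. -/
def e2 {n : ℕ} (x : Fin n → ℝ) : ℝ := Real.sqrt (∑ i, (x i) ^ 2)

/-- The unit sphere `S^{n-1}` in `ℝⁿ`. -/
def Sph (n : ℕ) : Set (Fin n → ℝ) := {x | e2 x = 1}

/-- The set `A_E = {x : xᵢ ≠ 0 ↔ i ∈ E}`. -/
def setA {n : ℕ} (E : Finset (Fin n)) : Set (Fin n → ℝ) := {x | ∀ i, x i ≠ 0 ↔ i ∈ E}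

/-- Finite signed Borel measures on `ℝⁿ`. -/
abbrev SM (n : ℕ) := MeasureTheory.SignedMeasure (Fin n → ℝ)

/-- A (finite) measure regarded as a signed measure (junk value `0` if not finite). -/
def toSigned {X : Type*} [MeasurableSpace X] (ρ : Measure X) : SignedMeasure X :=
  if h : IsFiniteMeasure ρ then @Measure.toSignedMeasure X _ ρ h else 0

/-- Multiplicative convolution of two non-negative measures. -/
def mconvPos {n : ℕ} (ρ σ : Measure (Fin n → ℝ)) : Measure (Fin n → ℝ) :=
  (ρ.prod σ).map (fun p => p.1 * p.2)

/-- Multiplicative convolution `μ ⊛ ν` of two signed measures, via Jordan decomposition. -/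
def mconv {n : ℕ} (μ ν : SM n) : SM n :=
  toSigned (mconvPos μ.toJordanDecomposition.posPart ν.toJordanDecomposition.posPart
      + mconvPos μ.toJordanDecomposition.negPart ν.toJordanDecomposition.negPart)
  - toSigned (mconvPos μ.toJordanDecomposition.posPart ν.toJordanDecomposition.negPart
      + mconvPos μ.toJordanDecomposition.negPart ν.toJordanDecomposition.posPart)

/-- `μ` is integrable: `∫ ‖x‖₂ d|μ| < ∞`. -/
def IntegrableSM {n : ℕ} (μ : SM n) : Prop :=
  ∫⁻ x, ENNReal.ofReal (e2 x) ∂μ.totalVariation < ⊤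

/-- `μ` is concentrated on `A`:  `|μ|(Aᶜ) = 0`. -/
def ConcOn {n : ℕ} (μ : SM n) (A : Set (Fin n → ℝ)) : Prop := μ.totalVariation Aᶜ = 0

/-- The multiple reflection `T_E` on `ℝⁿ`. -/
def flipE {n : ℕ} (E : Finset (Fin n)) (x : Fin n → ℝ) : Fin n → ℝ :=
  fun i => if i ∈ E then -x i else x i

/-- Pushforward of a signed measure under `T_E`. -/
def Tmap {n : ℕ} (E : Finset (Fin n)) (μ : SM n) : SM n := μ.map (flipE E)

def EvenUnder {n : ℕ} (μ : SM n) (E : Finset (Fin n)) : Prop := Tmap E μ = μ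
def OddUnder {n : ℕ} (μ : SM n) (E : Finset (Fin n)) : Prop := Tmap E μ = -μ

/-- Orthogonal projection onto the coordinate subspace `H_E`. -/
def projE {n : ℕ} (E : Finset (Fin n)) (x : Fin n → ℝ) : Fin n → ℝ :=
  fun i => if i ∈ E then x i else 0

/-- `P_E(μ)`: pushforward under `projE`. -/
def Pmap {n : ℕ} (E : Finset (Fin n)) (μ : SM n) : SM n := μ.map (projE E)

/-- `R_E(μ) = μ_E`: restriction to `A_E`. -/
def Rres {n : ℕ} (E : Finset (Fin n)) (μ : SM n) : SM n := μ.restrict (setA E)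

/-- Sign vector attached to `b : Fin n → Bool`. -/
def signVec {n : ℕ} (b : Fin n → Bool) : Fin n → ℝ := fun i => if b i then 1 else -1

/-- The measure `δ_J = 2^{-n} ∑_{s ∈ 𝒮ⁿ} σ_J(s) δ_s`. -/
def deltaJ {n : ℕ} (J : Finset (Fin n)) : SM n :=
  ((2 : ℝ) ^ n)⁻¹ •
    ∑ b : Fin n → Bool,
      (∏ j ∈ J, (if b j then (1 : ℝ) else -1)) • toSigned (Measure.dirac (signVec b))

/-- `𝒥(E; Fe, Fo)`. -/
def JsetE {n : ℕ} (E : Finset (Fin n)) (Fe Fo : Set (Finset (Fin n))) :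
    Set (Finset (Fin n)) :=
  {J | J ⊆ E ∧ (∀ F ∈ Fe, Even (J ∩ F).card) ∧ (∀ F ∈ Fo, Odd (J ∩ F).card)}

/-- `𝒥(Fe, Fo) = 𝒥([n]; Fe, Fo)`. -/
def Jset {n : ℕ} (Fe Fo : Set (Finset (Fin n))) : Set (Finset (Fin n)) :=
  {J | (∀ F ∈ Fe, Even (J ∩ F).card) ∧ (∀ F ∈ Fo, Odd (J ∩ F).card)}

/-- `G` has a representation `G = F₁ Δ … Δ F_m` with each `Fᵢ` drawn from `Fe` or `Fo`,
in which the number of terms drawn from `Fo` is even (`odd = false`) or odd (`odd = true`). -/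
def HasRep {n : ℕ} (Fe Fo : Set (Finset (Fin n))) (G : Finset (Fin n)) (odd : Bool) : Prop :=
  ∃ l : List (Finset (Fin n) × Bool),
    (∀ p ∈ l, if p.2 then p.1 ∈ Fo else p.1 ∈ Fe) ∧
    (l.map Prod.fst).foldr (· ∆ ·) ∅ = G ∧
    (l.countP (fun p => p.2)) % 2 = (if odd then 1 else 0)

/-- The generating pair `(Fe, Fo)` is proper: the even and odd parts of the generated group
are disjoint. -/
def ProperPair {n : ℕ} (Fe Fo : Set (Finset (Fin n))) : Prop :=
  ∀ G : Finset (Fin n), ¬ (HasRep Fe Fo G false ∧ HasRep Fe Fo G true)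

/-- `ℳ^int(A; Fe, Fo)`: integrable signed measures concentrated on `A`, even under `T_F`
for `F ∈ Fe` and odd under `T_F` for `F ∈ Fo`. -/
def MclassInt {n : ℕ} (A : Set (Fin n → ℝ)) (Fe Fo : Set (Finset (Fin n))) : Set (SM n) :=
  {μ | IntegrableSM μ ∧ ConcOn μ A ∧ (∀ F ∈ Fe, EvenUnder μ F) ∧ (∀ F ∈ Fo, OddUnder μ F)}

/-- `ν` is universal on `𝒜`. -/
def Universal {n : ℕ} (ν : SM n) (𝒜 : Set (SM n)) : Prop :=
  ∀ μ ∈ 𝒜, mconv ν μ = 0 → μ = 0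

/-- Radial projection of a non-negative measure. -/
def radPos {n : ℕ} (ρ : Measure (Fin n → ℝ)) : Measure (Fin n → ℝ) :=
  (ρ.withDensity fun x => ENNReal.ofReal (e2 x)).map (fun x => (e2 x)⁻¹ • x)

/-- Radial projection `P_S` of a signed measure. -/
def PS {n : ℕ} (μ : SM n) : SM n :=
  toSigned (radPos μ.toJordanDecomposition.posPart) -
    toSigned (radPos μ.toJordanDecomposition.negPart)

/-- The spherical product `μ ⊛_S ν = P_S(μ ⊛ ν)`. -/
def mconvS {n : ℕ} (μ ν : SM n) : SM n := PS (mconv μ ν)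

/-- `ν` is spherically universal on `𝒜`. -/
def SphUniversal {n : ℕ} (ν : SM n) (𝒜 : Set (SM n)) : Prop :=
  ∀ μ ∈ 𝒜, mconvS ν μ = 0 → μ = 0

/-- The unconditional symmetrisation `M_unc`. -/
def Munc {n : ℕ} (μ : SM n) : SM n := ((2 : ℝ) ^ n)⁻¹ • ∑ E : Finset (Fin n), Tmap E μ

/-- Integral of `f` against a signed measure. -/
def sInt {n : ℕ} (μ : SM n) (f : (Fin n → ℝ) → ℝ) : ℝ :=
  (∫ x, f x ∂μ.toJordanDecomposition.posPart) - ∫ x, f x ∂μ.toJordanDecomposition.negPart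

/-- `δ₁ ⊗ μ`: the lifting of `μ` to a measure on `ℝ^{n+1}`, with an extra `0`-th coordinate
carrying a unit atom at `1`. -/
def lift0 {n : ℕ} (μ : SM n) : SM (n + 1) := μ.map (fun x => Fin.cons 1 x)

/-- Symmetrisation about the origin. -/
def Msym {n : ℕ} (μ : SM n) : SM n := (2 : ℝ)⁻¹ • (μ + μ.map (fun x => -x))

/-- The lifting `L(μ) = P_S(M_sym(δ₁ ⊗ μ))`. -/
def Lift {n : ℕ} (μ : SM n) : SM (n + 1) := PS (Msym (lift0 μ))

/-- The multiplicative weight `∏ᵢ |xᵢ|^{aᵢ}`. -/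
def absPow {n : ℕ} (a x : Fin n → ℝ) : ℝ := ∏ i, |x i| ^ a i

/-- The character `∏_{j ∈ J} sign xⱼ` of the group of reflections. -/
def signChar {n : ℕ} (J : Finset (Fin n)) (x : Fin n → ℝ) : ℝ :=
  ∏ j ∈ J, (SignType.sign (x j) : ℝ)

/-- The open cube of exponents at which every integrable measure has a Mellin transform. -/
def expBox (n : ℕ) : Set (Fin n → ℝ) := Set.univ.pi fun _ => Set.Ioo 0 (1 / (n : ℝ))

/-- Finite measures concentrated on `A_{[n]}` for which all moments with exponents in `expBox n`
are finite. -/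
structure Admissible {n : ℕ} (ρ : Measure (Fin n → ℝ)) : Prop where
  finite : IsFiniteMeasure ρ
  null_compl : ρ (setA Finset.univ)ᶜ = 0
  integrable : ∀ a ∈ expBox n, Integrable (absPow a) ρ

/-- The Mellin transform of a measure at the character `J` and the real exponent `a`. -/
def mellinPos {n : ℕ} (ρ : Measure (Fin n → ℝ)) (J : Finset (Fin n)) (a : Fin n → ℝ) : ℝ :=
  ∫ x, signChar J x * absPow a x ∂ρ

/-- The Mellin transform of a signed measure. -/
def mellinSM {n : ℕ} (μ : SM n) (J : Finset (Fin n)) (a : Fin n → ℝ) : ℝ :=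
  mellinPos μ.toJordanDecomposition.posPart J a - mellinPos μ.toJordanDecomposition.negPart J a

section Basic

variable {n : ℕ}

lemma signChar_mul (J : Finset (Fin n)) (x y : Fin n → ℝ) :
    signChar J (x * y) = signChar J x * signChar J y := by
  simp [signChar, ← Finset.prod_mul_distrib, sign_mul]

@[simp]
lemma signChar_empty (x : Fin n → ℝ) : signChar ∅ x = 1 := by simp [signChar]

lemma absPow_mul (a x y : Fin n → ℝ) : absPow a (x * y) = absPow a x * absPow a y := by
  simp only [absPow, ← Finset.prod_mul_distrib, Pi.mul_apply, abs_mul]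
  exact Finset.prod_congr rfl fun i _ => Real.mul_rpow (abs_nonneg _) (abs_nonneg _)

lemma absPow_nonneg (a x : Fin n → ℝ) : 0 ≤ absPow a x :=
  Finset.prod_nonneg fun _ _ => Real.rpow_nonneg (abs_nonneg _) _

lemma mem_setA_univ {x : Fin n → ℝ} : x ∈ setA (Finset.univ : Finset (Fin n)) ↔ ∀ i, x i ≠ 0 := by
  simp [setA]

lemma absPow_pos {a x : Fin n → ℝ} (hx : x ∈ setA (Finset.univ : Finset (Fin n))) :
    0 < absPow a x :=
  Finset.prod_pos fun i _ => Real.rpow_pos_of_pos (abs_pos.2 (mem_setA_univ.1 hx i)) _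

lemma absPow_add {a b x : Fin n → ℝ} (hx : x ∈ setA (Finset.univ : Finset (Fin n))) :
    absPow (a + b) x = absPow a x * absPow b x := by
  simp only [absPow, ← Finset.prod_mul_distrib, Pi.add_apply]
  exact Finset.prod_congr rfl fun i _ => Real.rpow_add (abs_pos.2 (mem_setA_univ.1 hx i)) _ _

lemma absPow_eq_exp {a x : Fin n → ℝ} (hx : x ∈ setA (Finset.univ : Finset (Fin n))) :
    absPow a x = Real.exp (∑ i, a i * Real.log |x i|) := by
  rw [Real.exp_sum]
  refine Finset.prod_congr rfl fun i _ => ?_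
  rw [Real.rpow_def_of_pos (abs_pos.2 (mem_setA_univ.1 hx i)), mul_comm]

@[fun_prop]
lemma measurable_absPow (a : Fin n → ℝ) : Measurable (absPow a) := by
  unfold absPow
  fun_prop

@[fun_prop]
lemma measurable_sign_coe : Measurable fun r : ℝ => (SignType.sign r : ℝ) := by
  have h : (fun r : ℝ => (SignType.sign r : ℝ)) =
      fun r => if 0 < r then 1 else if r < 0 then -1 else 0 := by
    funext r
    rw [sign_apply]
    split_ifs <;> simp
  rw [h]
  exact Measurable.ite measurableSet_Ioi measurable_const
    (Measurable.ite measurableSet_Iio measurable_const measurable_const)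

@[fun_prop]
lemma measurable_signChar (J : Finset (Fin n)) : Measurable (signChar J) := by
  unfold signChar
  refine Finset.measurable_prod _ fun i _ => ?_
  exact measurable_sign_coe.comp (measurable_pi_apply i)

lemma abs_signChar_le_one (J : Finset (Fin n)) (x : Fin n → ℝ) : |signChar J x| ≤ 1 := by
  rw [signChar, Finset.abs_prod]
  refine Finset.prod_le_one (fun _ _ => abs_nonneg _) fun i _ => ?_
  rcases SignType.sign (x i) with _ | _ | _ <;> simp

lemma signChar_eq_of_mem {x : Fin n → ℝ} (hx : x ∈ setA (Finset.univ : Finset (Fin n)))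
    (J : Finset (Fin n)) : signChar J x = 1 ∨ signChar J x = -1 := by
  rw [signChar]
  induction J using Finset.induction_on with
  | empty => simp
  | insert i s hi ih =>
    rw [Finset.prod_insert hi]
    rcases (mem_setA_univ.1 hx i).lt_or_gt with h | h <;> rcases ih with ih | ih <;>
      simp [ih, sign_neg, sign_pos, h]

lemma measurableSet_setA_univ : MeasurableSet (setA (Finset.univ : Finset (Fin n))) := by
  have h : setA (Finset.univ : Finset (Fin n)) = ⋂ i, {x | x i ≠ 0} := by
    ext x; simp [mem_setA_univ]
  rw [h]
  exact MeasurableSet.iInter fun i => (measurable_pi_apply i) (measurableSet_singleton 0).compl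

namespace Admissible

variable {ρ σ : Measure (Fin n → ℝ)}

lemma ae_mem (h : Admissible ρ) : ∀ᵐ x ∂ρ, x ∈ setA (Finset.univ : Finset (Fin n)) :=
  h.null_compl

lemma integrable_char (h : Admissible ρ) (J : Finset (Fin n)) {a : Fin n → ℝ}
    (ha : a ∈ expBox n) : Integrable (fun x => signChar J x * absPow a x) ρ :=
  (h.integrable a ha).bdd_mul (by fun_prop) (c := 1)
    (Filter.Eventually.of_forall fun x => abs_signChar_le_one J x)

lemma add (h : Admissible ρ) (h' : Admissible σ) : Admissible (ρ + σ) where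
  finite := by
    have := h.finite
    have := h'.finite
    infer_instance
  null_compl := by simp [h.null_compl, h'.null_compl]
  integrable a ha := (h.integrable a ha).add_measure (h'.integrable a ha)

lemma mono (h : Admissible ρ) (hle : σ ≤ ρ) : Admissible σ where
  finite := by
    have := h.finite
    exact isFiniteMeasure_of_le ρ hle
  null_compl := le_antisymm ((hle _).trans h.null_compl.le) zero_le
  integrable a ha := (h.integrable a ha).mono_measure hle

lemma mconvPos (h : Admissible ρ) (h' : Admissible σ) : Admissible (mconvPos ρ σ) := by
  have := h.finite
  have := h'.finite
  have hm : Measurable fun p : (Fin n → ℝ) × (Fin n → ℝ) => p.1 * p.2 := by fun_prop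
  refine ⟨?_, ?_, fun a ha => ?_⟩
  · unfold _root_.mconvPos
    infer_instance
  · change ∀ᵐ x ∂_, x ∈ setA Finset.univ
    unfold _root_.mconvPos
    refine (ae_map_iff (p := (· ∈ setA Finset.univ)) hm.aemeasurable measurableSet_setA_univ).2 ?_
    filter_upwards [Measure.quasiMeasurePreserving_fst.ae h.ae_mem,
      Measure.quasiMeasurePreserving_snd.ae h'.ae_mem] with p hp hq
    rw [mem_setA_univ] at *
    exact fun i => mul_ne_zero (hp i) (hq i)
  · unfold _root_.mconvPos
    rw [integrable_map_measure (by fun_prop) hm.aemeasurable]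
    exact ((h.integrable a ha).mul_prod (h'.integrable a ha)).congr
      (Filter.Eventually.of_forall fun p => (absPow_mul a _ _).symm)

end Admissible

lemma mellinPos_add {ρ σ : Measure (Fin n → ℝ)} (h : Admissible ρ) (h' : Admissible σ)
    (J : Finset (Fin n)) {a : Fin n → ℝ} (ha : a ∈ expBox n) :
    mellinPos (ρ + σ) J a = mellinPos ρ J a + mellinPos σ J a :=
  integral_add_measure (h.integrable_char J ha) (h'.integrable_char J ha)

lemma mellinPos_mconvPos {ρ σ : Measure (Fin n → ℝ)} (h : Admissible ρ) (h' : Admissible σ)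
    (J : Finset (Fin n)) (a : Fin n → ℝ) :
    mellinPos (mconvPos ρ σ) J a = mellinPos ρ J a * mellinPos σ J a := by
  have := h.finite
  have := h'.finite
  rw [mellinPos, mconvPos, integral_map (by fun_prop) (by fun_prop), mellinPos, mellinPos,
    ← integral_prod_mul]
  refine integral_congr_ae (Filter.Eventually.of_forall fun p => ?_)
  simp only [signChar_mul, absPow_mul]
  ring

end Basic

/-- The measure with density `∏ᵢ |xᵢ|^{aᵢ}` with respect to `ρ`. -/
def tilt {n : ℕ} (a : Fin n → ℝ) (ρ : Measure (Fin n → ℝ)) : Measure (Fin n → ℝ) :=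
  ρ.withDensity fun x => ENNReal.ofReal (absPow a x)

/-- The linear combination `∑ᵢ dᵢ log |xᵢ|`. -/
def logForm {n : ℕ} (d x : Fin n → ℝ) : ℝ := ∑ i, d i * Real.log |x i|

section Mellin

open ProbabilityTheory

variable {n : ℕ}

@[fun_prop]
lemma measurable_logForm (d : Fin n → ℝ) : Measurable (logForm d) := by
  unfold logForm
  fun_prop

lemma isOpen_expBox : IsOpen (expBox n) := isOpen_set_pi Set.finite_univ fun _ _ => isOpen_Ioo

lemma convex_expBox : Convex ℝ (expBox n) := convex_pi fun _ _ => convex_Ioo _ _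

lemma isOpen_line (a d : Fin n → ℝ) : IsOpen {t : ℝ | a + t • d ∈ expBox n} :=
  isOpen_expBox.preimage (by fun_prop)

lemma isPreconnected_line (a d : Fin n → ℝ) : IsPreconnected {t : ℝ | a + t • d ∈ expBox n} := by
  refine Convex.isPreconnected fun s hs t ht p q hp hq hpq => ?_
  have h := convex_expBox hs ht hp hq hpq
  have e : p • (a + s • d) + q • (a + t • d) = a + (p • s + q • t) • d := by
    calc _ = (p + q) • a + (p • s + q • t) • d := by module
      _ = _ := by rw [hpq, one_smul]
  rwa [e] at h

lemma exp_mul_absPow {a d x : Fin n → ℝ} (hx : x ∈ setA (Finset.univ : Finset (Fin n))) (t : ℝ) :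
    absPow a x * Real.exp (t * logForm d x) = absPow (a + t • d) x := by
  rw [absPow_add hx, absPow_eq_exp (a := t • d) hx, logForm, Finset.mul_sum]
  simp [mul_assoc]

namespace Admissible

variable {ρ σ : Measure (Fin n → ℝ)} {a d : Fin n → ℝ}

lemma isFiniteMeasure_tilt (h : Admissible ρ) (ha : a ∈ expBox n) :
    IsFiniteMeasure (tilt a ρ) :=
  isFiniteMeasure_withDensity_ofReal (h.integrable a ha).2

lemma subset_integrableExpSet (h : Admissible ρ) :
    {t : ℝ | a + t • d ∈ expBox n} ⊆ integrableExpSet (logForm d) (tilt a ρ) := by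
  intro t ht
  change Integrable _ _
  rw [tilt, integrable_withDensity_iff_integrable_smul' (by fun_prop) (by simp)]
  refine (h.integrable _ ht).congr ?_
  filter_upwards [h.ae_mem] with x hx
  rw [ENNReal.toReal_ofReal (absPow_nonneg a x), smul_eq_mul, exp_mul_absPow hx]

lemma subset_interior_integrableExpSet (h : Admissible ρ) :
    {t : ℝ | a + t • d ∈ expBox n} ⊆ interior (integrableExpSet (logForm d) (tilt a ρ)) :=
  interior_maximal h.subset_integrableExpSet (isOpen_line a d)

lemma mgf_tilt (h : Admissible ρ) (a d : Fin n → ℝ) (t : ℝ) :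
    mgf (logForm d) (tilt a ρ) t = mellinPos ρ ∅ (a + t • d) := by
  rw [mgf, tilt, integral_withDensity_eq_integral_toReal_smul (by fun_prop) (by simp), mellinPos]
  refine integral_congr_ae ?_
  filter_upwards [h.ae_mem] with x hx
  rw [ENNReal.toReal_ofReal (absPow_nonneg a x), smul_eq_mul, exp_mul_absPow hx, signChar_empty, one_mul]

lemma analyticOnNhd_mellinPos_empty (h : Admissible ρ) (a d : Fin n → ℝ) :
    AnalyticOnNhd ℝ (fun t : ℝ => mellinPos ρ ∅ (a + t • d)) {t : ℝ | a + t • d ∈ expBox n} := by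
  have h' := (analyticOnNhd_mgf (X := logForm d) (μ := tilt a ρ)).mono
    (h.subset_interior_integrableExpSet (a := a) (d := d))
  simpa only [funext fun t => h.mgf_tilt a d t] using h'

lemma mellinPos_eq_sub (h : Admissible ρ) (J : Finset (Fin n)) (ha : a ∈ expBox n) :
    mellinPos ρ J a = mellinPos (ρ.restrict {x | signChar J x = 1}) ∅ a -
      mellinPos (ρ.restrict {x | signChar J x = -1}) ∅ a := by
  have m (c : ℝ) : MeasurableSet {x : Fin n → ℝ | signChar J x = c} :=
    (measurable_signChar J) (measurableSet_singleton c)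
  have hi (c : ℝ) := (h.integrable_char ∅ ha).indicator (m c)
  simp only [mellinPos]
  rw [← integral_indicator (m _), ← integral_indicator (m _), ← integral_sub (hi 1) (hi (-1))]
  refine integral_congr_ae ?_
  filter_upwards [h.ae_mem] with x hx
  rcases signChar_eq_of_mem hx J with hJ | hJ <;>
    norm_num [Set.indicator, hJ]

lemma analyticOnNhd_mellinPos (h : Admissible ρ) (J : Finset (Fin n)) (a d : Fin n → ℝ) :
    AnalyticOnNhd ℝ (fun t : ℝ => mellinPos ρ J (a + t • d)) {t : ℝ | a + t • d ∈ expBox n} := by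
  have h1 := (h.mono (Measure.restrict_le_self (s := {x | signChar J x = 1}))
    ).analyticOnNhd_mellinPos_empty a d
  have h2 := (h.mono (Measure.restrict_le_self (s := {x | signChar J x = -1}))
    ).analyticOnNhd_mellinPos_empty a d
  refine (h1.sub h2).congr (isOpen_line a d) fun t ht => ?_
  exact (h.mellinPos_eq_sub J ht).symm

lemma complexMGF_tilt_eq (h : Admissible ρ) (h' : Admissible σ)
    (heq : ∀ b ∈ expBox n, mellinPos ρ ∅ b = mellinPos σ ∅ b) (ha : a ∈ expBox n)
    (d : Fin n → ℝ) :
    complexMGF (logForm d) (tilt a ρ) Complex.I = complexMGF (logForm d) (tilt a σ) Complex.I := by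
  set U := {t : ℝ | a + t • d ∈ expBox n} with hU
  have h0 : (0 : ℝ) ∈ U := by simpa [hU] using ha
  have hX : AnalyticOnNhd ℂ (complexMGF (logForm d) (tilt a ρ)) {z | z.re ∈ U} :=
    analyticOnNhd_complexMGF.mono fun z hz => h.subset_interior_integrableExpSet hz
  have hY : AnalyticOnNhd ℂ (complexMGF (logForm d) (tilt a σ)) {z | z.re ∈ U} :=
    analyticOnNhd_complexMGF.mono fun z hz => h'.subset_interior_integrableExpSet hz
  have hpre : IsPreconnected {z : ℂ | z.re ∈ U} :=
    (((isPreconnected_line a d).ordConnected.convex).linear_preimage Complex.reLm).isPreconnected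
  refine AnalyticOnNhd.eqOn_of_preconnected_of_frequently_eq hX hY hpre (z₀ := 0)
    (by simpa using h0) ?_ (by simpa using h0)
  have h_real : ∃ᶠ x : ℝ in nhdsWithin 0 {0}ᶜ,
      complexMGF (logForm d) (tilt a ρ) x = complexMGF (logForm d) (tilt a σ) x := by
    refine Filter.Eventually.frequently ?_
    filter_upwards [nhdsWithin_le_nhds ((isOpen_line a d).mem_nhds h0)] with x hx
    rw [complexMGF_ofReal, complexMGF_ofReal, h.mgf_tilt, h'.mgf_tilt, heq _ hx]
  refine Filter.Tendsto.frequently (f := ((↑) : ℝ → ℂ)) ?_ h_real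
  refine tendsto_nhdsWithin_of_tendsto_nhds_of_eventually_within _ ?_ ?_
  · exact (Complex.continuous_ofReal.tendsto' 0 0 Complex.ofReal_zero).mono_left nhdsWithin_le_nhds
  · filter_upwards [self_mem_nhdsWithin] with x hx
    simpa using hx

lemma map_log_tilt_eq (h : Admissible ρ) (h' : Admissible σ)
    (heq : ∀ b ∈ expBox n, mellinPos ρ ∅ b = mellinPos σ ∅ b) (ha : a ∈ expBox n) :
    (tilt a ρ).map (fun x i => Real.log |x i|) = (tilt a σ).map (fun x i => Real.log |x i|) := by
  have := h.isFiniteMeasure_tilt ha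
  have := h'.isFiniteMeasure_tilt ha
  have hm : Measurable fun (x : Fin n → ℝ) i => Real.log |x i| := by fun_prop
  refine Measure.ext_of_charFunDual ?_
  ext L
  have key (τ : Measure (Fin n → ℝ)) : charFunDual (τ.map fun x i => Real.log |x i|) L =
      complexMGF (logForm fun i => L (Pi.single i 1)) τ Complex.I := by
    rw [charFunDual_apply, integral_map hm.aemeasurable (by fun_prop), complexMGF]
    refine integral_congr_ae (Filter.Eventually.of_forall fun x => ?_)
    have hL : L (fun i => Real.log |x i|) = logForm (fun i => L (Pi.single i 1)) x := by
      rw [logForm, ← L.coe_coe, LinearMap.pi_apply_eq_sum_univ]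
      refine Finset.sum_congr rfl fun i _ => ?_
      simp only [smul_eq_mul, mul_comm, ContinuousLinearMap.coe_coe]
      congr 2
      ext j
      simp [Pi.single_apply, eq_comm]
    simp only [hL, mul_comm]
  rw [key, key, complexMGF_tilt_eq h h' heq ha]

end Admissible

end Mellin

/-- The open orthant with sign pattern `b`. -/
def orthant {n : ℕ} (b : Fin n → Bool) : Set (Fin n → ℝ) := {x | ∀ i, 0 < signVec b i * x i}

section Uniqueness

variable {n : ℕ}

lemma signVec_ne_zero (b : Fin n → Bool) (i : Fin n) : signVec b i ≠ 0 := by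
  unfold signVec
  split_ifs <;> norm_num

lemma measurableSet_orthant (b : Fin n → Bool) : MeasurableSet (orthant b) := by
  have h : orthant b = ⋂ i, {x : Fin n → ℝ | 0 < signVec b i * x i} := by ext x; simp [orthant]
  rw [h]
  exact MeasurableSet.iInter fun i => measurableSet_lt measurable_const (by fun_prop)

lemma iUnion_orthant : ⋃ b, orthant b = setA (Finset.univ : Finset (Fin n)) := by
  ext x
  simp only [Set.mem_iUnion, mem_setA_univ, orthant, Set.mem_ofPred_eq]
  constructor
  · rintro ⟨b, hb⟩ i h
    simpa [h] using hb i
  · intro h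
    refine ⟨fun i => decide (0 < x i), fun i => ?_⟩
    rcases (h i).lt_or_gt with hi | hi
    · simp [signVec, hi.not_gt, hi]
    · simp [signVec, hi]

lemma indicator_orthant (b : Fin n → Bool) {x : Fin n → ℝ}
    (hx : x ∈ setA (Finset.univ : Finset (Fin n))) :
    (orthant b).indicator 1 x =
      ((2 : ℝ) ^ n)⁻¹ * ∑ J : Finset (Fin n), (∏ j ∈ J, signVec b j) * signChar J x := by
  have hsum : ∑ J : Finset (Fin n), (∏ j ∈ J, signVec b j) * signChar J x =
      ∏ i, (1 + signVec b i * (SignType.sign (x i) : ℝ)) := by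
    rw [Finset.prod_one_add, Finset.powerset_univ]
    simp [signChar, Finset.prod_mul_distrib]
  have hfac (i : Fin n) : 1 + signVec b i * (SignType.sign (x i) : ℝ) =
      if 0 < signVec b i * x i then 2 else 0 := by
    rcases (mem_setA_univ.1 hx i).lt_or_gt with hi | hi <;> rcases hb : b i <;>
      simp [signVec, hb, hi, hi.not_gt] <;> norm_num
  rw [hsum]
  by_cases hmem : x ∈ orthant b
  · rw [Set.indicator_of_mem hmem,
      Finset.prod_congr rfl fun i _ => (hfac i).trans (if_pos (hmem i))]
    simp
  · obtain ⟨i, hi⟩ : ∃ i, ¬ 0 < signVec b i * x i := by simpa [orthant] using hmem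
    rw [Set.indicator_of_notMem hmem,
      Finset.prod_eq_zero (Finset.mem_univ i) ((hfac i).trans (if_neg hi)), mul_zero]

namespace Admissible

variable {ρ σ : Measure (Fin n → ℝ)}

lemma mellinPos_restrict_orthant (h : Admissible ρ) (b : Fin n → Bool) {a : Fin n → ℝ}
    (ha : a ∈ expBox n) :
    mellinPos (ρ.restrict (orthant b)) ∅ a =
      ((2 : ℝ) ^ n)⁻¹ * ∑ J : Finset (Fin n), (∏ j ∈ J, signVec b j) * mellinPos ρ J a := by
  simp only [mellinPos]
  rw [← integral_indicator (measurableSet_orthant b)]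
  simp only [← integral_const_mul]
  rw [← integral_finsetSum _ fun J _ => (h.integrable_char J ha).const_mul _, ← integral_const_mul]
  refine integral_congr_ae ?_
  filter_upwards [h.ae_mem] with x hx
  have e := congrArg (· * absPow a x) (indicator_orthant b hx)
  simp only [mul_assoc, Finset.sum_mul] at e
  rw [← e]
  by_cases hmem : x ∈ orthant b <;> simp [hmem]

lemma eq_of_map_log_tilt_eq {a : Fin n → ℝ} {b : Fin n → Bool}
    (hρ : ∀ᵐ x ∂ρ, x ∈ orthant b) (hσ : ∀ᵐ x ∂σ, x ∈ orthant b)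
    (heq : (tilt a ρ).map (fun x i => Real.log |x i|) =
      (tilt a σ).map (fun x i => Real.log |x i|)) : ρ = σ := by
  have hm : Measurable fun (x : Fin n → ℝ) i => Real.log |x i| := by fun_prop
  have hE : Measurable fun (v : Fin n → ℝ) i => signVec b i * Real.exp (v i) := by fun_prop
  have inv {x : Fin n → ℝ} (hx : x ∈ orthant b) :
      (fun i => signVec b i * Real.exp (Real.log |x i|)) = x := by
    funext i
    have hi := hx i
    have hx0 : x i ≠ 0 := by rintro h0; simp [h0] at hi
    rw [Real.exp_log (abs_pos.2 hx0)]
    rcases hb : b i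
    · have : x i < 0 := by simpa [signVec, hb] using hi
      simp [signVec, hb, abs_of_neg this]
    · have : 0 < x i := by simpa [signVec, hb] using hi
      simp [signVec, hb, abs_of_pos this]
  have recover {τ : Measure (Fin n → ℝ)} (hτ : ∀ᵐ x ∂τ, x ∈ orthant b) :
      ((tilt a τ).map (fun x i => Real.log |x i|)).map
        (fun v i => signVec b i * Real.exp (v i)) = tilt a τ := by
    rw [Measure.map_map hE hm]
    refine (Measure.map_congr (g := id) ?_).trans Measure.map_id
    refine (withDensity_absolutelyContinuous _ _).ae_le ?_
    filter_upwards [hτ] with x hx using inv hx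
  have untilt {τ : Measure (Fin n → ℝ)} (hτ : ∀ᵐ x ∂τ, x ∈ orthant b) :
      (tilt a τ).withDensity (fun x => (ENNReal.ofReal (absPow a x))⁻¹) = τ := by
    refine withDensity_inv_same (by fun_prop) ?_ (by simp)
    filter_upwards [hτ] with x hx
    have hx' : x ∈ setA Finset.univ := iUnion_orthant.subset (Set.mem_iUnion_of_mem b hx)
    simpa using absPow_pos hx'
  rw [← untilt hρ, ← untilt hσ, ← recover hρ, ← recover hσ, heq]

lemma expBox_nonempty (hn : 1 ≤ n) : (expBox n).Nonempty :=
  ⟨fun _ => 1 / (n : ℝ) / 2, fun i _ => by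
    have : (0 : ℝ) < 1 / n := by positivity
    constructor <;> linarith⟩

/-- The Mellin transform determines an admissible measure. -/
theorem ext_of_mellinPos (hn : 1 ≤ n) (h : Admissible ρ) (h' : Admissible σ)
    (heq : ∀ J, ∀ a ∈ expBox n, mellinPos ρ J a = mellinPos σ J a) : ρ = σ := by
  obtain ⟨a, ha⟩ := expBox_nonempty hn
  rw [← Measure.restrict_eq_self_of_ae_mem h.ae_mem, ← Measure.restrict_eq_self_of_ae_mem h'.ae_mem,
    ← iUnion_orthant, Measure.restrict_iUnion_congr]
  intro b
  refine eq_of_map_log_tilt_eq (a := a) (ae_restrict_mem (measurableSet_orthant b))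
    (ae_restrict_mem (measurableSet_orthant b)) ?_
  refine map_log_tilt_eq (h.mono Measure.restrict_le_self) (h'.mono Measure.restrict_le_self)
    (fun c hc => ?_) ha
  rw [h.mellinPos_restrict_orthant b hc, h'.mellinPos_restrict_orthant b hc]
  simp only [heq _ c hc]

end Admissible

end Uniqueness

/-- Signed measures whose Jordan parts are admissible. -/
def AdmissibleSM {n : ℕ} (μ : SM n) : Prop :=
  Admissible μ.toJordanDecomposition.posPart ∧ Admissible μ.toJordanDecomposition.negPart

section Signed

variable {n : ℕ}

lemma toSigned_eq {X : Type*} [MeasurableSpace X] (ρ : Measure X) [h : IsFiniteMeasure ρ] :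
    toSigned ρ = ρ.toSignedMeasure := by
  rw [toSigned, dif_pos h]

lemma abs_le_e2 (x : Fin n → ℝ) (i : Fin n) : |x i| ≤ e2 x :=
  Real.abs_le_sqrt (Finset.single_le_sum (f := fun j => x j ^ 2) (fun _ _ => sq_nonneg _)
    (Finset.mem_univ i))

@[fun_prop]
lemma measurable_e2 : Measurable (e2 : (Fin n → ℝ) → ℝ) := by
  unfold e2
  fun_prop

lemma absPow_le {a : Fin n → ℝ} (ha : a ∈ expBox n) (x : Fin n → ℝ) :
    absPow a x ≤ 1 + e2 x := by
  have h0 : 0 ≤ e2 x := Real.sqrt_nonneg _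
  have ha' (i : Fin n) : 0 < a i ∧ a i < 1 / n := ha i trivial
  have hsum : ∑ i, a i ≤ 1 := by
    calc ∑ i, a i ≤ ∑ _i : Fin n, 1 / (n : ℝ) := Finset.sum_le_sum fun i _ => (ha' i).2.le
      _ ≤ 1 := by
        simp only [Finset.sum_const, Finset.card_univ, Fintype.card_fin, nsmul_eq_mul]
        rw [mul_one_div]
        exact div_self_le_one _
  calc absPow a x ≤ ∏ i, (1 + e2 x) ^ a i := Finset.prod_le_prod
        (fun i _ => Real.rpow_nonneg (abs_nonneg _) _) fun i _ =>
        Real.rpow_le_rpow (abs_nonneg _) (by linarith [abs_le_e2 x i]) (ha' i).1.le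
    _ = (1 + e2 x) ^ ∑ i, a i := (Real.rpow_sum_of_pos (by linarith) _ _).symm
    _ ≤ (1 + e2 x) ^ (1 : ℝ) := Real.rpow_le_rpow_of_exponent_le (by linarith) hsum
    _ = 1 + e2 x := Real.rpow_one _

lemma admissibleSM_of_integrableSM {μ : SM n} (hint : IntegrableSM μ)
    (hconc : ConcOn μ (setA (Finset.univ : Finset (Fin n)))) : AdmissibleSM μ := by
  have hfin : IsFiniteMeasure μ.totalVariation := by
    unfold SignedMeasure.totalVariation
    infer_instance
  have he : Integrable e2 μ.totalVariation := by
    refine ⟨by fun_prop, ?_⟩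
    rw [hasFiniteIntegral_iff_ofReal (f := e2)
      (Filter.Eventually.of_forall fun x => Real.sqrt_nonneg _)]
    exact hint
  have h : Admissible μ.totalVariation := by
    refine ⟨hfin, hconc, fun a ha => ?_⟩
    refine ((integrable_const (1 : ℝ)).add he).mono' (by fun_prop)
      (Filter.Eventually.of_forall fun x => ?_)
    rw [Real.norm_of_nonneg (absPow_nonneg a x)]
    exact absPow_le ha x
  exact ⟨h.mono (Measure.le_add_right le_rfl), h.mono (Measure.le_add_left le_rfl)⟩

lemma toSigned_sub_eq_zero_iff {X : Type*} [MeasurableSpace X] (ρ σ : Measure X)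
    [IsFiniteMeasure ρ] [IsFiniteMeasure σ] : toSigned ρ - toSigned σ = 0 ↔ ρ = σ := by
  rw [toSigned_eq, toSigned_eq, sub_eq_zero, Measure.toSignedMeasure_eq_toSignedMeasure_iff]

lemma AdmissibleSM.mconv_eq_zero_iff (hn : 1 ≤ n) {μ ν : SM n} (hμ : AdmissibleSM μ)
    (hν : AdmissibleSM ν) : mconv μ ν = 0 ↔
      ∀ J, ∀ a ∈ expBox n, mellinSM μ J a * mellinSM ν J a = 0 := by
  set p := μ.toJordanDecomposition with hp
  set q := ν.toJordanDecomposition with hq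
  have pp := hμ.1.mconvPos hν.1
  have pm := hμ.1.mconvPos hν.2
  have mp := hμ.2.mconvPos hν.1
  have mm := hμ.2.mconvPos hν.2
  have h1 := pp.add mm
  have h2 := pm.add mp
  have := h1.finite
  have := h2.finite
  have key (J : Finset (Fin n)) {a : Fin n → ℝ} (ha : a ∈ expBox n) :
      mellinSM μ J a * mellinSM ν J a =
        mellinPos (mconvPos p.posPart q.posPart + mconvPos p.negPart q.negPart) J a -
          mellinPos (mconvPos p.posPart q.negPart + mconvPos p.negPart q.posPart) J a := by
    rw [mellinPos_add pp mm J ha, mellinPos_add pm mp J ha, mellinPos_mconvPos hμ.1 hν.1,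
      mellinPos_mconvPos hμ.1 hν.2, mellinPos_mconvPos hμ.2 hν.1, mellinPos_mconvPos hμ.2 hν.2,
      mellinSM, mellinSM, ← hp, ← hq]
    ring
  rw [mconv, ← hp, ← hq, toSigned_sub_eq_zero_iff]
  constructor
  · intro h J a ha
    rw [key J ha, h, sub_self]
  · intro h
    refine Admissible.ext_of_mellinPos hn h1 h2 fun J a ha => ?_
    rw [← sub_eq_zero, ← key J ha, h J a ha]

lemma AdmissibleSM.eq_zero_of_mellinSM (hn : 1 ≤ n) {μ : SM n} (hμ : AdmissibleSM μ)
    (h : ∀ J, ∀ a ∈ expBox n, mellinSM μ J a = 0) : μ = 0 := by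
  have e := Admissible.ext_of_mellinPos hn hμ.1 hμ.2 fun J a ha => sub_eq_zero.1 (h J a ha)
  rw [← μ.toSignedMeasure_toJordanDecomposition, JordanDecomposition.toSignedMeasure, sub_eq_zero]
  exact Measure.toSignedMeasure_congr e

lemma AdmissibleSM.mellinSM_eq_zero_or_eq_zero {μ ν : SM n} (hμ : AdmissibleSM μ)
    (hν : AdmissibleSM ν) (J : Finset (Fin n))
    (h : ∀ a ∈ expBox n, mellinSM μ J a * mellinSM ν J a = 0) :
    (∀ a ∈ expBox n, mellinSM μ J a = 0) ∨ ∀ a ∈ expBox n, mellinSM ν J a = 0 := by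
  by_contra! hcon
  obtain ⟨⟨a, ha, hμa⟩, b, hb, hνb⟩ := hcon
  have an {η : SM n} (hη : AdmissibleSM η) : AnalyticOnNhd ℝ
      (fun t : ℝ => mellinSM η J (a + t • (b - a))) {t : ℝ | a + t • (b - a) ∈ expBox n} :=
    (hη.1.analyticOnNhd_mellinPos J a _).sub (hη.2.analyticOnNhd_mellinPos J a _)
  rcases AnalyticOnNhd.eq_zero_or_eq_zero_of_mul_eq_zero (an hμ) (an hν)
    (fun t ht => h _ ht) (isPreconnected_line a _) with h0 | h0
  · exact hμa (by simpa using h0 0 (by simpa using ha))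
  · exact hνb (by simpa using h0 1 (by simpa using hb))

lemma AdmissibleSM.neg {μ : SM n} (hμ : AdmissibleSM μ) : AdmissibleSM (-μ) := by
  rw [AdmissibleSM, SignedMeasure.toJordanDecomposition_neg]
  exact ⟨hμ.2, hμ.1⟩

lemma mellinSM_neg (μ : SM n) (J : Finset (Fin n)) (a : Fin n → ℝ) :
    mellinSM (-μ) J a = -mellinSM μ J a := by
  rw [mellinSM, mellinSM, SignedMeasure.toJordanDecomposition_neg, JordanDecomposition.neg_posPart,
    JordanDecomposition.neg_negPart, neg_sub]

lemma signChar_flipE (J F : Finset (Fin n)) (x : Fin n → ℝ) :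
    signChar J (flipE F x) = (-1) ^ (J ∩ F).card * signChar J x := by
  have h (j : Fin n) : (SignType.sign (flipE F x j) : ℝ) =
      (if j ∈ F then -1 else 1) * (SignType.sign (x j) : ℝ) := by
    by_cases hj : j ∈ F <;> simp [flipE, hj, Left.sign_neg]
  simp only [signChar, h, Finset.prod_mul_distrib]
  rw [Finset.prod_ite_mem, Finset.prod_const]

lemma absPow_flipE (a : Fin n → ℝ) (F : Finset (Fin n)) (x : Fin n → ℝ) :
    absPow a (flipE F x) = absPow a x := by
  refine Finset.prod_congr rfl fun i _ => ?_
  by_cases hi : i ∈ F <;> simp [flipE, hi]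

@[fun_prop]
lemma measurable_flipE (F : Finset (Fin n)) : Measurable (flipE F) := by
  refine measurable_pi_lambda _ fun i => ?_
  by_cases hi : i ∈ F <;> simp only [flipE, hi, if_true, if_false] <;> fun_prop

lemma mellinPos_map_flipE (ρ : Measure (Fin n → ℝ)) (F J : Finset (Fin n)) (a : Fin n → ℝ) :
    mellinPos (ρ.map (flipE F)) J a = (-1) ^ (J ∩ F).card * mellinPos ρ J a := by
  rw [mellinPos, integral_map (by fun_prop) (by fun_prop), mellinPos, ← integral_const_mul]
  simp only [signChar_flipE, absPow_flipE, mul_assoc]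

lemma Admissible.map_flipE {ρ : Measure (Fin n → ℝ)} (h : Admissible ρ) (F : Finset (Fin n)) :
    Admissible (ρ.map (flipE F)) := by
  have := h.finite
  refine ⟨inferInstance, ?_, fun a ha => ?_⟩
  · rw [Measure.map_apply (by fun_prop) measurableSet_setA_univ.compl]
    convert h.null_compl using 2
    ext x
    simp only [Set.mem_preimage, Set.mem_compl_iff, mem_setA_univ, flipE]
    refine not_congr (forall_congr' fun i => ?_)
    split_ifs <;> simp
  · rw [integrable_map_measure (by fun_prop) (by fun_prop)]
    exact (h.integrable a ha).congr (Filter.Eventually.of_forall fun x => (absPow_flipE a F x).symm)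

lemma AdmissibleSM.mellinSM_of_apply_eq {μ : SM n} (hμ : AdmissibleSM μ)
    {ρ σ : Measure (Fin n → ℝ)} (hρ : Admissible ρ) (hσ : Admissible σ)
    (h : ∀ A, MeasurableSet A → μ A = ρ.real A - σ.real A) (J : Finset (Fin n)) {a : Fin n → ℝ}
    (ha : a ∈ expBox n) : mellinSM μ J a = mellinPos ρ J a - mellinPos σ J a := by
  have := hρ.finite
  have := hσ.finite
  have e : μ.toJordanDecomposition.posPart + σ = ρ + μ.toJordanDecomposition.negPart := by
    ext A hA
    rw [← measureReal_eq_measureReal_iff, measureReal_add_apply, measureReal_add_apply]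
    have h1 := h A hA
    rw [μ.apply_eq_posPart_real_sub_negPart_real hA] at h1
    linarith
  have e' := congrArg (mellinPos · J a) e
  simp only [mellinPos_add hμ.1 hσ J ha, mellinPos_add hρ hμ.2 J ha] at e'
  rw [mellinSM]
  linarith

lemma AdmissibleSM.mellinSM_Tmap {μ η : SM n} (hμ : AdmissibleSM μ) (hη : AdmissibleSM η)
    {F : Finset (Fin n)} (h : Tmap F μ = η) (J : Finset (Fin n)) {a : Fin n → ℝ}
    (ha : a ∈ expBox n) : mellinSM η J a = (-1) ^ (J ∩ F).card * mellinSM μ J a := by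
  rw [hη.mellinSM_of_apply_eq (hμ.1.map_flipE F) (hμ.2.map_flipE F) ?_ J ha, mellinPos_map_flipE,
    mellinPos_map_flipE, mellinSM, mul_sub]
  intro A hA
  rw [← h, Tmap, VectorMeasure.map_apply _ (by fun_prop) hA,
    μ.apply_eq_posPart_real_sub_negPart_real (measurable_flipE F hA),
    map_measureReal_apply (by fun_prop) hA, map_measureReal_apply (by fun_prop) hA]

lemma AdmissibleSM.even_card_of_evenUnder {μ : SM n} (hμ : AdmissibleSM μ) {F J : Finset (Fin n)}
    (h : EvenUnder μ F) {a : Fin n → ℝ} (ha : a ∈ expBox n) (hne : mellinSM μ J a ≠ 0) :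
    Even (J ∩ F).card := by
  by_contra hodd
  have := hμ.mellinSM_Tmap hμ h J ha
  rw [(Nat.not_even_iff_odd.1 hodd).neg_one_pow] at this
  exact hne (by linarith)

lemma AdmissibleSM.odd_card_of_oddUnder {μ : SM n} (hμ : AdmissibleSM μ) {F J : Finset (Fin n)}
    (h : OddUnder μ F) {a : Fin n → ℝ} (ha : a ∈ expBox n) (hne : mellinSM μ J a ≠ 0) :
    Odd (J ∩ F).card := by
  by_contra heven
  have := hμ.mellinSM_Tmap hμ.neg h J ha
  rw [(Nat.not_odd_iff_even.1 heven).neg_one_pow, mellinSM_neg] at this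
  exact hne (by linarith)

end Signed

section Delta

variable {n : ℕ}

lemma deltaJ_apply (J : Finset (Fin n)) {A : Set (Fin n → ℝ)} (hA : MeasurableSet A) :
    deltaJ J A = ((2 : ℝ) ^ n)⁻¹ * ∑ b : Fin n → Bool,
      (∏ j ∈ J, signVec b j) * A.indicator 1 (signVec b) := by
  simp only [deltaJ, toSigned_eq, _root_.smul_apply, _root_.sum_apply, smul_eq_mul]
  congr 1
  refine Finset.sum_congr rfl fun b _ => ?_
  rw [Measure.toSignedMeasure_apply_measurable hA, measureReal_def, Measure.dirac_apply' _ hA]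
  by_cases h : signVec b ∈ A <;> simp [h, signVec]

lemma signVec_injective : Function.Injective (signVec : (Fin n → Bool) → Fin n → ℝ) := by
  intro b c h
  funext i
  have hi := congrFun h i
  cases hb : b i <;> cases hc : c i <;>
    first | rfl | (exfalso; norm_num [signVec, hb, hc] at hi)

lemma deltaJ_ne_zero (J : Finset (Fin n)) : deltaJ J ≠ 0 := by
  intro h
  have e := deltaJ_apply J (measurableSet_singleton (signVec fun _ : Fin n => true))
  rw [h, Finset.sum_eq_single (fun _ => true)] at e
  · simp [signVec] at e
    exact absurd e.symm (by positivity)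
  · intro b _ hb
    have : signVec b ∉ ({signVec fun _ => true} : Set (Fin n → ℝ)) :=
      fun hmem => hb (signVec_injective hmem)
    simp [this]
  · simp

lemma signVec_mem_setA (b : Fin n → Bool) : signVec b ∈ setA (Finset.univ : Finset (Fin n)) :=
  mem_setA_univ.2 (signVec_ne_zero b)

lemma e2_signVec (b : Fin n → Bool) : e2 (signVec b) = Real.sqrt n := by
  have h (i : Fin n) : signVec b i ^ 2 = 1 := by
    unfold signVec
    split_ifs <;> norm_num
  simp [e2, h]

lemma totalVariation_deltaJ_compl_range (J : Finset (Fin n)) :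
    (deltaJ J).totalVariation (Set.range signVec)ᶜ = 0 := by
  have hm : MeasurableSet (Set.range (signVec : (Fin n → Bool) → Fin n → ℝ)) :=
    (Set.finite_range _).measurableSet
  set τ : Measure (Fin n → ℝ) := ∑ b : Fin n → Bool, Measure.dirac (signVec b) with hτ
  have hac : deltaJ J ≪ᵥ τ.toENNRealVectorMeasure := by
    refine VectorMeasure.AbsolutelyContinuous.mk fun A hA h0 => ?_
    rw [Measure.toENNRealVectorMeasure_apply_measurable hA] at h0
    rw [deltaJ_apply J hA, Finset.sum_eq_zero fun b _ => ?_, mul_zero]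
    have hb : Measure.dirac (signVec b) A = 0 := by
      rw [hτ, Measure.finsetSum_apply, Finset.sum_eq_zero_iff] at h0
      exact h0 b (Finset.mem_univ b)
    rw [Measure.dirac_apply' _ hA] at hb
    have : signVec b ∉ A := by
      intro hmem
      simp [hmem] at hb
    simp [this]
  have hac' := ((deltaJ J).absolutelyContinuous_ennreal_iff _).1 hac
  rw [VectorMeasure.ennrealToMeasure_toENNRealVectorMeasure] at hac'
  refine hac' ?_
  rw [hτ, Measure.finsetSum_apply]
  refine Finset.sum_eq_zero fun b _ => ?_
  rw [Measure.dirac_apply' _ hm.compl]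
  simp

lemma concOn_deltaJ (J : Finset (Fin n)) :
    ConcOn (deltaJ J) (setA (Finset.univ : Finset (Fin n))) :=
  measure_mono_null (Set.compl_subset_compl.2 (Set.range_subset_iff.2 signVec_mem_setA))
    (totalVariation_deltaJ_compl_range J)

lemma integrableSM_deltaJ (J : Finset (Fin n)) : IntegrableSM (deltaJ J) := by
  have hfin : IsFiniteMeasure (deltaJ J).totalVariation := by
    unfold SignedMeasure.totalVariation
    infer_instance
  have hae : ∀ᵐ x ∂(deltaJ J).totalVariation, x ∈ Set.range signVec :=
    totalVariation_deltaJ_compl_range J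
  have h : ∫⁻ x, ENNReal.ofReal (e2 x) ∂(deltaJ J).totalVariation =
      ∫⁻ _, ENNReal.ofReal (Real.sqrt n) ∂(deltaJ J).totalVariation := by
    refine lintegral_congr_ae ?_
    filter_upwards [hae] with x hx
    obtain ⟨b, rfl⟩ := hx
    rw [e2_signVec]
  rw [IntegrableSM, h, lintegral_const]
  exact ENNReal.mul_lt_top ENNReal.ofReal_lt_top (measure_lt_top _ _)

lemma admissibleSM_deltaJ (J : Finset (Fin n)) : AdmissibleSM (deltaJ J) :=
  admissibleSM_of_integrableSM (integrableSM_deltaJ J) (concOn_deltaJ J)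

/-- Flipping the signs in `F`, on the level of Boolean sign patterns. -/
def flipBool (F : Finset (Fin n)) (b : Fin n → Bool) : Fin n → Bool :=
  fun i => if i ∈ F then !b i else b i

lemma flipBool_involutive (F : Finset (Fin n)) : Function.Involutive (flipBool F) := by
  intro b
  funext i
  by_cases hi : i ∈ F <;> simp [flipBool, hi]

lemma signVec_flipBool (F : Finset (Fin n)) (b : Fin n → Bool) :
    signVec (flipBool F b) = flipE F (signVec b) := by
  funext i
  by_cases hi : i ∈ F <;> cases hb : b i <;> simp [signVec, flipBool, flipE, hi, hb]

lemma prod_signVec (J : Finset (Fin n)) (b : Fin n → Bool) :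
    ∏ j ∈ J, signVec b j = signChar J (signVec b) := by
  refine Finset.prod_congr rfl fun j _ => ?_
  cases hb : b j <;> simp [signVec, hb]

lemma Tmap_deltaJ (F J : Finset (Fin n)) :
    Tmap F (deltaJ J) = (-1 : ℝ) ^ (J ∩ F).card • deltaJ J := by
  ext A hA
  rw [Tmap, VectorMeasure.map_apply (deltaJ J) (measurable_flipE F) hA,
    deltaJ_apply J (measurable_flipE F hA),
    _root_.smul_apply, deltaJ_apply J hA, smul_eq_mul, mul_left_comm _ ((2 : ℝ) ^ n)⁻¹]
  congr 1
  rw [← Equiv.sum_comp (Function.Involutive.toPerm (flipBool F) (flipBool_involutive F)),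
    Finset.mul_sum]
  refine Finset.sum_congr rfl fun b _ => ?_
  have hsq : ((-1 : ℝ) ^ (J ∩ F).card) * (-1) ^ (J ∩ F).card = 1 := by
    rw [← mul_pow]; simp
  have hflip : flipE F (flipE F (signVec b)) = signVec b := by
    rw [← signVec_flipBool, ← signVec_flipBool, flipBool_involutive F b]
  have hind : (flipE F ⁻¹' A).indicator (1 : (Fin n → ℝ) → ℝ) (flipE F (signVec b)) =
      A.indicator 1 (signVec b) := by
    simp only [Set.indicator, Set.mem_preimage, hflip, Pi.one_apply]
  rw [Function.Involutive.coe_toPerm, prod_signVec, prod_signVec, signVec_flipBool, hind,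
    signChar_flipE, mul_assoc]

lemma evenUnder_deltaJ {F J : Finset (Fin n)} (h : Even (J ∩ F).card) :
    EvenUnder (deltaJ J) F := by
  rw [EvenUnder, Tmap_deltaJ, h.neg_one_pow, one_smul]

lemma oddUnder_deltaJ {F J : Finset (Fin n)} (h : Odd (J ∩ F).card) :
    OddUnder (deltaJ J) F := by
  rw [OddUnder, Tmap_deltaJ, h.neg_one_pow]
  exact neg_one_smul ℝ (deltaJ J)

lemma mellinSM_deltaJ_of_ne {J K : Finset (Fin n)} (hJK : K ≠ J) {a : Fin n → ℝ}
    (ha : a ∈ expBox n) : mellinSM (deltaJ J) K a = 0 := by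
  by_contra hne
  refine hJK ?_
  ext i
  by_cases hi : i ∈ J
  · have h := (admissibleSM_deltaJ J).odd_card_of_oddUnder
      (oddUnder_deltaJ (F := {i}) (by simp [hi])) ha hne
    by_contra hK
    simp [show i ∉ K by tauto] at h
  · have h := (admissibleSM_deltaJ J).even_card_of_evenUnder
      (evenUnder_deltaJ (F := {i}) (by simp [hi])) ha hne
    by_contra hK
    simp [show i ∈ K by tauto] at h

end Delta

section Representation

variable {n : ℕ} {Fe Fo : Set (Finset (Fin n))}

lemma hasRep_empty : HasRep Fe Fo ∅ false := ⟨[], by simp, by simp, by simp⟩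

lemma hasRep_of_mem_even {F : Finset (Fin n)} (hF : F ∈ Fe) : HasRep Fe Fo F false :=
  ⟨[(F, false)], by simpa using hF, by simp, by simp⟩

lemma hasRep_of_mem_odd {F : Finset (Fin n)} (hF : F ∈ Fo) : HasRep Fe Fo F true :=
  ⟨[(F, true)], by simpa using hF, by simp, by simp⟩

lemma foldr_symmDiff_append (l l' : List (Finset (Fin n))) :
    (l ++ l').foldr (· ∆ ·) ∅ = l.foldr (· ∆ ·) ∅ ∆ l'.foldr (· ∆ ·) ∅ := by
  induction l with
  | nil => exact (bot_symmDiff _).symm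
  | cons F l ih => simp only [List.cons_append, List.foldr_cons, ih, symmDiff_assoc]

lemma HasRep.symmDiff {G G' : Finset (Fin n)} {b b' : Bool} (h : HasRep Fe Fo G b)
    (h' : HasRep Fe Fo G' b') : HasRep Fe Fo (G ∆ G') (xor b b') := by
  obtain ⟨l, hl, rfl, hb⟩ := h
  obtain ⟨l', hl', rfl, hb'⟩ := h'
  refine ⟨l ++ l', fun p hp => ?_, by rw [List.map_append, foldr_symmDiff_append], ?_⟩
  · rcases List.mem_append.1 hp with hp | hp
    exacts [hl p hp, hl' p hp]
  · rw [List.countP_append, Nat.add_mod, hb, hb']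
    cases b <;> cases b' <;> rfl

/-- The indicator vector of `F` over the field with two elements. -/
def indVec (F : Finset (Fin n)) : Fin n → ZMod 2 := fun i => if i ∈ F then 1 else 0

/-- The span of the generators, each with an extra coordinate recording whether it is odd. -/
def repSpan (Fe Fo : Set (Finset (Fin n))) : Submodule (ZMod 2) ((Fin n → ZMod 2) × ZMod 2) :=
  Submodule.span (ZMod 2) ((fun F => (indVec F, 0)) '' Fe ∪ (fun F => (indVec F, 1)) '' Fo)

lemma filter_indVec (F : Finset (Fin n)) :
    (Finset.univ.filter fun i => indVec F i = 1) = F := by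
  ext i
  simp [indVec]

lemma zmod_two_add_eq_one_iff (x y : ZMod 2) :
    x + y = 1 ↔ x = 1 ∧ ¬y = 1 ∨ y = 1 ∧ ¬x = 1 := by
  revert x y
  decide

lemma hasRep_of_mem_repSpan {w : (Fin n → ZMod 2) × ZMod 2} (hw : w ∈ repSpan Fe Fo) :
    HasRep Fe Fo (Finset.univ.filter fun i => w.1 i = 1) (decide (w.2 = 1)) := by
  have add_mem (u v : (Fin n → ZMod 2) × ZMod 2)
      (hu : HasRep Fe Fo (Finset.univ.filter fun i => u.1 i = 1) (decide (u.2 = 1)))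
      (hv : HasRep Fe Fo (Finset.univ.filter fun i => v.1 i = 1) (decide (v.2 = 1))) :
      HasRep Fe Fo (Finset.univ.filter fun i => (u + v).1 i = 1) (decide ((u + v).2 = 1)) := by
    convert hu.symmDiff hv using 1
    · ext i
      simp [Finset.mem_symmDiff, zmod_two_add_eq_one_iff]
    · rw [Prod.snd_add, Bool.eq_iff_iff, decide_eq_true_iff, zmod_two_add_eq_one_iff]
      by_cases h : u.2 = 1 <;> by_cases h' : v.2 = 1 <;> simp [h, h']
  have zero_mem : HasRep Fe Fo
      (Finset.univ.filter fun i => (0 : (Fin n → ZMod 2) × ZMod 2).1 i = 1)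
      (decide ((0 : (Fin n → ZMod 2) × ZMod 2).2 = 1)) := by
    simpa using hasRep_empty
  induction hw using Submodule.span_induction with
  | mem w hw =>
    rcases hw with ⟨F, hF, rfl⟩ | ⟨F, hF, rfl⟩
    · simpa [filter_indVec] using hasRep_of_mem_even hF
    · simpa [filter_indVec] using hasRep_of_mem_odd hF
  | zero => exact zero_mem
  | add u v _ _ hu hv => exact add_mem u v hu hv
  | smul c w _ hw =>
    obtain rfl | rfl : c = 0 ∨ c = 1 := by
      revert c
      decide
    · simpa only [zero_smul] using zero_mem
    · simpa only [one_smul] using hw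

lemma indVec_mem_repSpan_imp {G : Finset (Fin n)} {c : ZMod 2}
    (h : (indVec G, c) ∈ repSpan Fe Fo) : HasRep Fe Fo G (decide (c = 1)) := by
  simpa [filter_indVec] using hasRep_of_mem_repSpan h

lemma functional_indVec (φ : ((Fin n → ZMod 2) × ZMod 2) →ₗ[ZMod 2] ZMod 2)
    (F : Finset (Fin n)) (c : ZMod 2) :
    φ (indVec F, c) =
      (((Finset.univ.filter fun i => φ (Pi.single i 1, 0) = 1) ∩ F).card : ZMod 2) +
        c * φ (0, 1) := by
  have hsplit : ((indVec F, c) : (Fin n → ZMod 2) × ZMod 2) =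
      (∑ i ∈ F, (Pi.single i 1, 0)) + c • (0, 1) := by
    ext i
    · simp [Prod.fst_sum, Finset.sum_apply, Pi.single_apply, indVec]
    · simp [Prod.snd_sum]
  rw [hsplit, map_add, map_sum, map_smul, smul_eq_mul, Finset.inter_comm,
    ← Finset.filter_mem_eq_inter, Finset.card_filter]
  push_cast
  congr 1
  refine Finset.sum_congr rfl fun i _ => ?_
  have key : ∀ x : ZMod 2, x = if x = 1 then 1 else 0 := by decide
  simpa using key (φ (Pi.single i 1, 0))

lemma exists_functional (hproper : ProperPair Fe Fo) {E : Finset (Fin n)} {c : ZMod 2}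
    (hE : (indVec E, c) ∉ repSpan Fe Fo) :
    ∃ φ : ((Fin n → ZMod 2) × ZMod 2) →ₗ[ZMod 2] ZMod 2,
      repSpan Fe Fo ≤ LinearMap.ker φ ∧ φ (0, 1) = 1 ∧ φ (indVec E, c) ≠ 0 := by
  have one_of_ne : ∀ x : ZMod 2, x ≠ 0 → x = 1 := by decide
  obtain ⟨φ, hφE, hφ⟩ := Submodule.exists_le_ker_of_notMem hE
  have h01 : ((0, 1) : (Fin n → ZMod 2) × ZMod 2) ∉ repSpan Fe Fo := by
    intro h
    refine hproper ∅ ⟨hasRep_empty, ?_⟩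
    simpa using hasRep_of_mem_repSpan h
  obtain ⟨ψ, hψ1, hψ⟩ := Submodule.exists_le_ker_of_notMem h01
  by_cases h1 : φ (0, 1) = 0
  · by_cases h2 : ψ (indVec E, c) = 0
    · refine ⟨φ + ψ, fun w hw => ?_, ?_, ?_⟩
      · have h3 : φ w = 0 := hφ hw
        have h4 : ψ w = 0 := hψ hw
        simp [h3, h4]
      · simpa [h1] using one_of_ne _ hψ1
      · simpa [h2] using hφE
    · exact ⟨ψ, hψ, one_of_ne _ hψ1, h2⟩
  · exact ⟨φ, hφ, one_of_ne _ h1, hφE⟩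

/-- Duality between the sign patterns `J` compatible with a proper generating pair and the
sets represented by that pair. -/
lemma hasRep_of_forall_mem_Jset (hproper : ProperPair Fe Fo) {E : Finset (Fin n)} {c : ZMod 2}
    (h : ∀ J ∈ Jset Fe Fo, ((J ∩ E).card : ZMod 2) = c) :
    HasRep Fe Fo E (decide (c = 1)) := by
  refine indVec_mem_repSpan_imp ?_
  by_contra hE
  obtain ⟨φ, hφ, h1, hφE⟩ := exists_functional hproper hE
  have sum_zero : ∀ x y : ZMod 2, x = y ↔ x + y * 1 = 0 := by decide
  refine hφE ?_
  rw [functional_indVec, h1, ← sum_zero]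
  refine h _ ⟨fun F hF => ?_, fun F hF => ?_⟩
  · have hz : φ (indVec F, 0) = 0 := hφ (Submodule.subset_span (Or.inl ⟨F, hF, rfl⟩))
    rw [functional_indVec, h1, ← sum_zero] at hz
    exact ZMod.natCast_eq_zero_iff_even.1 hz
  · have hz : φ (indVec F, 1) = 0 := hφ (Submodule.subset_span (Or.inr ⟨F, hF, rfl⟩))
    rw [functional_indVec, h1, ← sum_zero] at hz
    exact ZMod.natCast_eq_one_iff_odd.1 hz

end Representation

lemma AdmissibleSM.exists_mellinSM_ne_zero {n : ℕ} (hn : 1 ≤ n) {ν : SM n}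
    (hν : AdmissibleSM ν) {J : Finset (Fin n)} (h : mconv (deltaJ J) ν ≠ 0) :
    ∃ a ∈ expBox n, mellinSM ν J a ≠ 0 := by
  by_contra! hz
  refine h (((admissibleSM_deltaJ J).mconv_eq_zero_iff hn hν).2 fun K a ha => ?_)
  by_cases hKJ : K = J
  · rw [hKJ, hz a ha, mul_zero]
  · rw [mellinSM_deltaJ_of_ne hKJ ha, zero_mul]

/-- Theorem: universality on `ℳ^int(A_{[n]}; Fe, Fo)` for a proper generating pair,
with the supplement on reflection symmetries of `ν`. -/
theorem stmt0 {n : ℕ} (hn : 1 ≤ n) (ν : SM n)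
    (hint : IntegrableSM ν)
    (hconc : ConcOn ν (setA (Finset.univ : Finset (Fin n))))
    (Fe Fo : Set (Finset (Fin n))) (hproper : ProperPair Fe Fo) :
    (Universal ν (MclassInt (setA (Finset.univ : Finset (Fin n))) Fe Fo) ↔
      ∀ J ∈ Jset Fe Fo, mconv (deltaJ J) ν ≠ 0) ∧
    (Universal ν (MclassInt (setA (Finset.univ : Finset (Fin n))) Fe Fo) →
      ∀ E : Finset (Fin n),
        (EvenUnder ν E → HasRep Fe Fo E false) ∧
        (OddUnder ν E → HasRep Fe Fo E true)) := by
  have hν := admissibleSM_of_integrableSM hint hconc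
  have delta_iff (J : Finset (Fin n)) : mconv (deltaJ J) ν = 0 ↔ mconv ν (deltaJ J) = 0 := by
    rw [(admissibleSM_deltaJ J).mconv_eq_zero_iff hn hν, hν.mconv_eq_zero_iff hn
      (admissibleSM_deltaJ J)]
    simp only [mul_comm]
  have delta_ne : Universal ν (MclassInt (setA (Finset.univ : Finset (Fin n))) Fe Fo) →
      ∀ J ∈ Jset Fe Fo, mconv (deltaJ J) ν ≠ 0 := by
    intro huniv J hJ h0
    exact deltaJ_ne_zero J (huniv _ ⟨integrableSM_deltaJ J, concOn_deltaJ J,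
      fun F hF => evenUnder_deltaJ (hJ.1 F hF), fun F hF => oddUnder_deltaJ (hJ.2 F hF)⟩
      ((delta_iff J).1 h0))
  refine ⟨⟨delta_ne, fun h μ hμ h0 => ?_⟩, fun huniv E => ⟨fun hE => ?_, fun hE => ?_⟩⟩
  · obtain ⟨hμint, hμconc, heven, hodd⟩ := hμ
    have hμ := admissibleSM_of_integrableSM hμint hμconc
    refine hμ.eq_zero_of_mellinSM hn fun J a ha => ?_
    by_contra hne
    obtain ⟨c, hc, hcne⟩ := hν.exists_mellinSM_ne_zero hn (h J
      ⟨fun F hF => hμ.even_card_of_evenUnder (heven F hF) ha hne,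
        fun F hF => hμ.odd_card_of_oddUnder (hodd F hF) ha hne⟩)
    rcases hν.mellinSM_eq_zero_or_eq_zero hμ J ((hν.mconv_eq_zero_iff hn hμ).1 h0 J) with hz | hz
    exacts [hcne (hz c hc), hne (hz a ha)]
  · simpa using hasRep_of_forall_mem_Jset hproper (E := E) (c := 0) fun J hJ => by
      obtain ⟨a, ha, hne⟩ := hν.exists_mellinSM_ne_zero hn (delta_ne huniv J hJ)
      exact ZMod.natCast_eq_zero_iff_even.2 (hν.even_card_of_evenUnder hE ha hne)
  · simpa using hasRep_of_forall_mem_Jset hproper (E := E) (c := 1) fun J hJ => by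
      obtain ⟨a, ha, hne⟩ := hν.exists_mellinSM_ne_zero hn (delta_ne huniv J hJ)
      exact ZMod.natCast_eq_one_iff_odd.2 (hν.odd_card_of_oddUnder hE ha hne)

end
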